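/- Fix m ≥ 1. In ℂ^m (EuclideanSpace ℂ (Fin m)) let e₁ = (1,0,…,0) and let B be the open ball of radius 1/2 centered at (1/2)·e₁. Define f : ℂ^m → ℂ by f(z) = g(z₁), where g(w) = exp(-(1-w)^{-1/2}) (principal power) for w ≠ 1 and g(1) = 0. Then f restricted to B does not extend holomorphically across the boundary point e₁: there do not exist an open set U ⊆ ℂ^m with e₁ ∈ U and a function F : ℂ^m → ℂ holomorphic on U (DifferentiableOn ℂ F U) such that F(z) = f(z) for all z ∈ U ∩ B. -/

import Mathlib

/-- The function of the counterexample: `g w = exp (-(1-w)^(-1/2))` for `w ≠ 1`,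
`g 1 = 0`. -/
noncomputable def g (w : ℂ) : ℂ :=
  if w = 1 then 0 else Complex.exp (-(1 - w) ^ (-(1 : ℂ)/2))

open Filter Topology

theorem g_one_sub_inv_sq {x : ℝ} (hx : 0 < x) :
    g (1 - ((x : ℂ) ^ 2)⁻¹) = Complex.exp (-(x : ℂ)) := by
  have hx' : (x : ℂ) ≠ 0 := by exact_mod_cast hx.ne'
  have h1 : (1 : ℂ) - ((x : ℂ) ^ 2)⁻¹ ≠ 1 := by
    intro h
    have : ((x : ℂ) ^ 2)⁻¹ = 0 := by linear_combination -h
    simp [hx'] at this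
  have h2 : (((x : ℂ) ^ 2)⁻¹) ^ (-(1 : ℂ) / 2) = x := by
    have hr : ((x ^ 2)⁻¹ : ℝ) ^ (-(1 : ℝ) / 2) = x := by
      rw [Real.inv_rpow (by positivity), ← Real.rpow_natCast, ← Real.rpow_mul hx.le,
        ← Real.rpow_neg hx.le]
      norm_num
    have := Complex.ofReal_cpow (x := (x ^ 2)⁻¹) (by positivity) (-(1 : ℝ) / 2)
    rw [hr] at this
    push_cast at this
    exact this.symm
  simp only [g, if_neg h1, sub_sub_cancel, h2]

theorem tendsto_one_sub_inv_sq :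
    Tendsto (fun x : ℝ => (1 : ℂ) - ((x : ℂ) ^ 2)⁻¹) atTop (𝓝 1) := by
  have h : Tendsto (fun x : ℝ => 1 - (x ^ 2)⁻¹) atTop (𝓝 (1 - 0)) :=
    tendsto_const_nhds.sub (tendsto_inv_atTop_zero.comp (tendsto_pow_atTop two_ne_zero))
  have := (Complex.continuous_ofReal.tendsto _).comp h
  simpa [Function.comp_def] using this

/-- No function analytic at `1` agrees with `g` along the real segment ending at `1`. -/
theorem not_analyticAt_of_eventually_eq_g {h : ℂ → ℂ}
    (hg : ∀ᶠ x : ℝ in atTop, h (1 - ((x : ℂ) ^ 2)⁻¹) = g (1 - ((x : ℂ) ^ 2)⁻¹)) :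
    ¬ AnalyticAt ℂ h 1 := by
  intro ha
  have hexp : ∀ᶠ x : ℝ in atTop, h (1 - ((x : ℂ) ^ 2)⁻¹) = Complex.exp (-(x : ℂ)) := by
    filter_upwards [hg, eventually_gt_atTop 0] with x hx hx0
    rw [hx, g_one_sub_inv_sq hx0]
  have hne : ¬ ∀ᶠ z in 𝓝 (1 : ℂ), h z = 0 := by
    intro h0
    obtain ⟨x, hx, hx'⟩ := (hexp.and (tendsto_one_sub_inv_sq.eventually h0)).exists
    exact Complex.exp_ne_zero _ (hx.symm.trans hx')
  obtain ⟨n, k, hk, hk1, hfac⟩ := ha.exists_eventuallyEq_pow_smul_nonzero_iff.mpr hne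
  have hlim : Tendsto (fun x : ℝ => ‖k (1 - ((x : ℂ) ^ 2)⁻¹)‖) atTop (𝓝 ‖k 1‖) :=
    (hk.continuousAt.tendsto.comp tendsto_one_sub_inv_sq).norm
  have hzero : Tendsto (fun x : ℝ => ‖k (1 - ((x : ℂ) ^ 2)⁻¹)‖) atTop (𝓝 0) := by
    refine (Real.tendsto_pow_mul_exp_neg_atTop_nhds_zero (2 * n)).congr' ?_
    filter_upwards [hexp, tendsto_one_sub_inv_sq.eventually hfac, eventually_gt_atTop 0]
      with x hx hxf hx0
    rw [hx] at hxf
    have hn := congrArg norm hxf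
    simp only [Complex.norm_exp, smul_eq_mul, norm_mul, norm_pow, sub_sub_cancel_left, norm_neg,
      norm_inv, Complex.norm_real, Real.norm_of_nonneg hx0.le, Complex.neg_re,
      Complex.ofReal_re] at hn
    rw [hn, pow_mul, ← mul_assoc, ← mul_pow, mul_inv_cancel₀ (by positivity), one_pow, one_mul]
  exact hk1 (norm_eq_zero.mp (tendsto_nhds_unique hlim hzero))

/-- In `ℂ^m` with `e₁ = (1,0,…,0)` and `B` the open ball of radius `1/2`
centered at `(1/2) • e₁`, the function `f z = g z₁`, restricted to `B`, does not
extend holomorphically across the boundary point `e₁`. -/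
theorem f_not_holomorphically_extendable (m : ℕ) (hm : 1 ≤ m) :
    ¬ ∃ (U : Set (EuclideanSpace ℂ (Fin m))), IsOpen U ∧
        EuclideanSpace.single (⟨0, hm⟩ : Fin m) (1 : ℂ) ∈ U ∧
        ∃ F : EuclideanSpace ℂ (Fin m) → ℂ, DifferentiableOn ℂ F U ∧
          ∀ z ∈ U ∩ Metric.ball
              ((1/2 : ℂ) • EuclideanSpace.single (⟨0, hm⟩ : Fin m) (1 : ℂ)) (1/2),
            F z = g (z ⟨0, hm⟩) := by
  rintro ⟨U, hU, he, F, hF, hFg⟩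
  set e := EuclideanSpace.single (⟨0, hm⟩ : Fin m) (1 : ℂ) with he_def
  have hline : Continuous fun w : ℂ => w • e := by fun_prop
  have hV : IsOpen ((fun w : ℂ => w • e) ⁻¹' U) := hU.preimage hline
  have h1 : (fun w : ℂ => w • e) ⁻¹' U ∈ 𝓝 (1 : ℂ) := hV.mem_nhds (by simpa using he)
  have hd : DifferentiableOn ℂ (fun w : ℂ => F (w • e)) ((fun w : ℂ => w • e) ⁻¹' U) :=
    hF.comp (by fun_prop) (Set.mapsTo_preimage _ _)
  refine not_analyticAt_of_eventually_eq_g ?_ (hd.analyticAt h1)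
  filter_upwards [tendsto_one_sub_inv_sq.eventually h1, eventually_gt_atTop 1] with x hxU hx
  have hball : (1 - ((x : ℂ) ^ 2)⁻¹) • e ∈ Metric.ball ((1/2 : ℂ) • e) (1/2) := by
    have hpos : 0 < (x ^ 2)⁻¹ := by positivity
    have hlt : (x ^ 2)⁻¹ < 1 := inv_lt_one_of_one_lt₀ (one_lt_pow₀ hx two_ne_zero)
    have hcast : (1 : ℂ) - ((x : ℂ) ^ 2)⁻¹ - 1/2 = ((1/2 - (x ^ 2)⁻¹ : ℝ) : ℂ) := by
      push_cast
      ring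
    rw [Metric.mem_ball, dist_eq_norm, ← sub_smul, norm_smul, hcast, Complex.norm_real,
      Real.norm_eq_abs, he_def, PiLp.norm_single, norm_one, mul_one, abs_lt]
    constructor <;> linarith
  rw [hFg _ ⟨hxU, hball⟩]
  simp [he_def]
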